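/- arXiv:1101.3626 — 3 statements merged into one kernel-verified Lean document; each statement's English description precedes it below -/
import Mathlib

section
/- Let b ∈ ℝ and let (b_n) be a real sequence with b_n ∈ (-2n, 2n) for every n and b_n → b. For each n define p_n = 1/2 − b_n/(4n) ∈ (0,1) and the map f_n : [0,1] → [0,1], f_n(s) = p_n / (1 − (1 − p_n) s) (which is well defined since 1 − (1 − p_n)s ≥ p_n > 0 on [0,1]). Then for every δ > 0, n · (1 − f_n^{∘⌊nδ⌋}(0)) converges, as n → ∞, to h(b, δ), where h(b, δ) = b/(1 − e^{−bδ}) if b ≠ 0 and h(0, δ) = 1/δ. (Since 1 − f_n^{∘k}(0) equals the probability that a Galton–Watson process with geometric offspring distribution of parameter p_n survives to generation k, this is the survival-probability asymptotic of Lemma 2.1.) -/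
open Filter Real

lemma aux_iter (p : ℝ) (hp : 0 < p) (hp1 : p < 1) (k : ℕ) :
    1 - (fun s : ℝ => p / (1 - (1 - p) * s))^[k] 0
      = 1 / (∑ i ∈ Finset.range (k+1), (p / (1 - p)) ^ i) := by
  have hq : 0 < 1 - p := by linarith
  have hr : 0 < p / (1 - p) := div_pos hp hq
  induction k with
  | zero => simp
  | succ k ih =>
    rw [Function.iterate_succ_apply']
    set s := (fun s : ℝ => p / (1 - (1 - p) * s))^[k] 0
    rw [Finset.sum_range_succ', pow_zero]
    simp_rw [pow_succ]
    rw [← Finset.sum_mul]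
    have hS : 0 < ∑ i ∈ Finset.range (k+1), (p / (1 - p)) ^ i :=
      Finset.sum_pos (fun i _ => pow_pos hr i) (by simp)
    set S := ∑ i ∈ Finset.range (k+1), (p / (1 - p)) ^ i
    have hs : s = 1 - 1 / S := by linarith
    have h1 : 1 - (1 - p) * s = (p * S + (1 - p)) / S := by
      rw [hs]; field_simp; ring
    have h2 : 0 < p * S + (1 - p) := by positivity
    have h3 : S * (p / (1 - p)) + 1 = (p * S + (1 - p)) / (1 - p) := by
      field_simp
    show 1 - p / (1 - (1 - p) * s) = _
    rw [h1, h3]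
    field_simp
    ring

/-- Survival probability asymptotics for a Galton–Watson process with geometric
offspring distribution of parameter `p_n = 1/2 - b_n/(4n)` (Lemma 2.1):
`n * (1 - f_n^{∘⌊nδ⌋}(0)) → h(b,δ)` where `f_n` is the generating function. -/
theorem stmt_0 (b : ℝ) (bseq : ℕ → ℝ)
    (hrange : ∀ n : ℕ, 1 ≤ n → -(2 * (n : ℝ)) < bseq n ∧ bseq n < 2 * (n : ℝ))
    (hlim : Tendsto bseq atTop (nhds b)) (δ : ℝ) (hδ : 0 < δ) :
    Tendsto (fun n : ℕ =>
        (n : ℝ) *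
          (1 - (fun s : ℝ =>
              (1/2 - bseq n / (4 * (n : ℝ))) /
                (1 - (1 - (1/2 - bseq n / (4 * (n : ℝ)))) * s))^[⌊(n : ℝ) * δ⌋₊] 0))
      atTop
      (nhds (if b = 0 then 1 / δ else b / (1 - Real.exp (-b * δ)))) := by
  set r : ℕ → ℝ := fun n => (1/2 - bseq n / (4 * (n : ℝ))) / (1 - (1/2 - bseq n / (4 * (n : ℝ)))) with hr
  set k : ℕ → ℕ := fun n => ⌊(n : ℝ) * δ⌋₊ with hk
  have hp : ∀ n : ℕ, 1 ≤ n → 0 < 1/2 - bseq n / (4 * (n : ℝ)) ∧ 1/2 - bseq n / (4 * (n : ℝ)) < 1 := by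
    intro n hn
    have hn' : (0:ℝ) < n := by exact_mod_cast hn
    obtain ⟨h1, h2⟩ := hrange n hn
    have h3 : bseq n / (4 * (n : ℝ)) < 1/2 := by rw [div_lt_iff₀ (by positivity)]; linarith
    have h4 : -(1/2) < bseq n / (4 * (n : ℝ)) := by rw [lt_div_iff₀ (by positivity)]; linarith
    constructor <;> linarith
  have hrpos : ∀ n : ℕ, 1 ≤ n → 0 < r n := fun n hn =>
    div_pos (hp n hn).1 (by linarith [(hp n hn).2])
  have hinv : Tendsto (fun n : ℕ => ((n:ℝ))⁻¹) atTop (nhds 0) := tendsto_inv_atTop_nhds_zero_nat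
  have hg : Tendsto (fun n : ℕ => (n:ℝ) * (r n - 1)) atTop (nhds (-b)) := by
    have h1 : Tendsto (fun n : ℕ => -bseq n / (1 + bseq n * ((n:ℝ))⁻¹ / 2)) atTop
        (nhds (-b / (1 + b * 0 / 2))) :=
      hlim.neg.div (((hlim.mul hinv).div_const 2).const_add 1) (by norm_num)
    have h2 : -b / (1 + b * 0 / 2) = -b := by simp
    rw [h2] at h1
    refine h1.congr' ?_
    filter_upwards [eventually_ge_atTop 1] with n hn
    have hn' : (0:ℝ) < n := by exact_mod_cast hn
    obtain ⟨h1, h2⟩ := hrange n hn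
    have h5 : 0 < 2 * (n:ℝ) + bseq n := by linarith
    have e1 : r n = (2 * n - bseq n) / (2 * n + bseq n) := by
      have : 1 - (1/2 - bseq n / (4 * (n : ℝ))) = (2 * n + bseq n) / (4 * n) := by
        field_simp; ring
      simp only [hr]
      rw [this]; field_simp; ring
    have e2 : 1 + bseq n * ((n:ℝ))⁻¹ / 2 = (2 * n + bseq n) / (2 * n) := by
      field_simp
    rw [e1, e2]; field_simp; ring
  have hlog : Tendsto (fun n : ℕ => (n:ℝ) * Real.log (r n)) atTop (nhds (-b)) := by
    have := Real.tendsto_nat_mul_log_one_add_of_tendsto hg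
    simpa using this
  have hkn : Tendsto (fun n : ℕ => (k n : ℝ) / n) atTop (nhds δ) := by
    have := (tendsto_nat_floor_mul_div_atTop hδ.le).comp (tendsto_natCast_atTop_atTop (R := ℝ))
    refine this.congr fun n => ?_
    simp [hk, mul_comm]
  have hkn1 : Tendsto (fun n : ℕ => ((k n + 1 : ℕ) : ℝ) / n) atTop (nhds δ) := by
    have := hkn.add hinv
    rw [add_zero] at this
    refine this.congr fun n => ?_
    push_cast; rw [add_div, one_div]
  have hpow : Tendsto (fun n : ℕ => r n ^ (k n + 1)) atTop (nhds (Real.exp (-b * δ))) := by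
    have := (Real.continuous_exp.tendsto _).comp (hlog.mul hkn1)
    refine this.congr' ?_
    filter_upwards [eventually_ge_atTop 1] with n hn
    have hn' : (0:ℝ) < n := by exact_mod_cast hn
    have e : (n:ℝ) * Real.log (r n) * (((k n + 1 : ℕ) : ℝ) / n) = ((k n + 1 : ℕ) : ℝ) * Real.log (r n) := by
      field_simp
    simp only [Function.comp]
    rw [e, Real.exp_nat_mul, Real.exp_log (hrpos n hn)]
  have key : Tendsto (fun n : ℕ => (n:ℝ) * (1 / (∑ i ∈ Finset.range (k n+1), (r n) ^ i))) atTop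
      (nhds (if b = 0 then 1 / δ else b / (1 - Real.exp (-b * δ)))) := by
    split_ifs with hb
    · subst hb
      simp only [neg_zero, zero_mul, Real.exp_zero] at hpow
      have hmin := (tendsto_const_nhds (x := (1:ℝ))).min hpow
      have hmax := (tendsto_const_nhds (x := (1:ℝ))).max hpow
      rw [min_self] at hmin
      rw [max_self] at hmax
      have hlo := hkn1.mul hmin
      have hhi := hkn1.mul hmax
      rw [mul_one] at hlo hhi
      have hb : ∀ n : ℕ, 1 ≤ n → ∀ i ∈ Finset.range (k n + 1),
          min 1 (r n ^ (k n + 1)) ≤ r n ^ i ∧ r n ^ i ≤ max 1 (r n ^ (k n + 1)) := by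
        intro n hn i hi
        have hi' : i ≤ k n + 1 := (Finset.mem_range.1 hi).le
        rcases le_total (r n) 1 with h | h
        · exact ⟨min_le_of_right_le (pow_le_pow_of_le_one (hrpos n hn).le h hi'),
            le_max_of_le_left (pow_le_one₀ (hrpos n hn).le h)⟩
        · exact ⟨min_le_of_left_le (one_le_pow₀ h),
            le_max_of_le_right (pow_le_pow_right₀ h hi')⟩
      have hS : Tendsto (fun n : ℕ => (∑ i ∈ Finset.range (k n+1), (r n) ^ i) / n) atTop (nhds δ) := by
        refine tendsto_of_tendsto_of_tendsto_of_le_of_le' hlo hhi ?_ ?_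
        · filter_upwards [eventually_ge_atTop 1] with n hn
          rw [div_mul_eq_mul_div]
          gcongr
          have := Finset.card_nsmul_le_sum _ _ _ (fun i hi => (hb n hn i hi).1)
          simpa using this
        · filter_upwards [eventually_ge_atTop 1] with n hn
          rw [div_mul_eq_mul_div]
          gcongr
          have := Finset.sum_le_card_nsmul _ _ _ (fun i hi => (hb n hn i hi).2)
          simpa using this
      have := hS.inv₀ hδ.ne'
      rw [one_div]
      refine this.congr fun n => ?_
      rw [inv_div]; ring
    · have hne : Real.exp (-b * δ) - 1 ≠ 0 := by
        rw [sub_ne_zero, Ne, Real.exp_eq_one_iff]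
        simp [hb, hδ.ne']
      have := hg.div (hpow.sub_const 1) hne
      have e : -b / (Real.exp (-b * δ) - 1) = b / (1 - Real.exp (-b * δ)) := by
        rw [← neg_sub 1 (Real.exp _), neg_div_neg_eq]
      rw [e] at this
      refine this.congr' ?_
      filter_upwards [hg.eventually_ne (neg_ne_zero.2 hb)] with n hn
      have h1 : r n ≠ 1 := by
        intro h; simp [h] at hn
      simp only [Pi.div_apply]
      rw [geom_sum_eq h1, one_div_div, mul_div_assoc]
  refine key.congr' ?_
  filter_upwards [eventually_ge_atTop 1] with n hn
  rw [aux_iter _ (hp n hn).1 (hp n hn).2]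
end

section
/- Let n ≥ 1 be an integer, b ∈ ℝ with 0 ≤ b ≤ 2n, and s ∈ [0,1). Then the generating function of the geometric distribution with parameter 1/2 − b/(4n) satisfies ( 1/2 − b/(4n) ) / ( 1 − (1/2 + b/(4n)) s ) ≤ (1/(2−s)) · ( 1 − b(1−s)/((2−s)·n) ). -/
/-- The key comparison inequality in the proof of Lemma 2.2: the generating function
of the geometric distribution with parameter `1/2 - b/(4n)` satisfies
`(1/2 - b/(4n)) / (1 - (1/2 + b/(4n)) s) ≤ (1/(2-s)) (1 - b(1-s)/((2-s)n))`. -/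
theorem stmt_7 (n : ℕ) (hn : 1 ≤ n) (b : ℝ) (hb0 : 0 ≤ b) (hb : b ≤ 2 * (n : ℝ))
    (s : ℝ) (hs : s ∈ Set.Ico (0:ℝ) 1) :
    (1/2 - b / (4 * (n : ℝ))) / (1 - (1/2 + b / (4 * (n : ℝ))) * s) ≤
      (1 / (2 - s)) * (1 - b * (1 - s) / ((2 - s) * (n : ℝ))) := by
  obtain ⟨h0, h1⟩ := hs
  have hn0 : (0:ℝ) < n := by exact_mod_cast hn
  obtain ⟨x, hx⟩ : ∃ x : ℝ, x = b / (4 * (n : ℝ)) := ⟨_, rfl⟩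
  have hbx : b = 4 * x * n := by rw [hx]; field_simp
  have hx0 : 0 ≤ x := by rw [hx]; positivity
  have hx1 : x ≤ 1/2 := by
    rw [hx, div_le_iff₀ (by positivity)]; linarith
  have hu : 0 < 2 - s := by linarith
  have hd : 0 < 1 - (1/2 + x) * s := by nlinarith
  have hr : (1 / (2 - s)) * (1 - b * (1 - s) / ((2 - s) * (n : ℝ)))
      = ((2 - s) - 4 * x * (1 - s)) / (2 - s) ^ 2 := by
    rw [hbx]; field_simp
  rw [hr, ← hx, div_le_div_iff₀ hd (by positivity)]
  have key : 0 ≤ x ^ 2 * (s * (1 - s)) :=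
    mul_nonneg (sq_nonneg x) (mul_nonneg h0 (by linarith))
  nlinarith [key]
end

section
/- Let (ℓ_n) be a sequence of nondecreasing functions ℓ_n : [0, ∞) → [0, ∞) converging uniformly on compact sets to a continuous nondecreasing function ℓ : [0, ∞) → [0, ∞). For u ≥ 0 define the generalized inverses τ(u) = inf{ s ≥ 0 : ℓ(s) > u } and τ_n(u) = inf{ s ≥ 0 : ℓ_n(s) > u } (with inf ∅ = ∞). Let r > 0 be such that τ(r') < ∞ for some r' > r, and suppose τ is left-continuous at r, i.e. lim_{u ↑ r} τ(u) = τ(r). Then τ_n(r) → τ(r) as n → ∞. -/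
open Filter

/-- Analytic core of Lemma 4.12: convergence of generalized (right-continuous)
inverses. If nondecreasing functions `ℓ_n : [0,∞) → [0,∞)` converge uniformly on
compacts to a continuous nondecreasing `ℓ`, `τ(r') < ∞` (i.e. `{s ≥ 0 : ℓ(s) > r'}`
is nonempty) for some `r' > r`, and the inverse `τ` of `ℓ` is left-continuous at `r`,
then `τ_n(r) → τ(r)`. -/
theorem stmt_13 (ℓn : ℕ → ℝ → ℝ) (ℓ : ℝ → ℝ)
    (hmono_n : ∀ n, MonotoneOn (ℓn n) (Set.Ici 0))
    (hnonneg_n : ∀ n, ∀ s : ℝ, 0 ≤ s → 0 ≤ ℓn n s)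
    (hmono : MonotoneOn ℓ (Set.Ici 0))
    (hnonneg : ∀ s : ℝ, 0 ≤ s → 0 ≤ ℓ s)
    (hcont : ContinuousOn ℓ (Set.Ici 0))
    (hconv : ∀ K : ℝ, 0 < K →
      TendstoUniformlyOn (fun n => ℓn n) ℓ atTop (Set.Icc 0 K))
    (τ : ℝ → ℝ) (τn : ℕ → ℝ → ℝ)
    (hτ : ∀ u : ℝ, τ u = sInf {s : ℝ | 0 ≤ s ∧ u < ℓ s})
    (hτn : ∀ n, ∀ u : ℝ, τn n u = sInf {s : ℝ | 0 ≤ s ∧ u < ℓn n s})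
    (r : ℝ) (hr : 0 < r)
    (hfin : ∃ r' : ℝ, r < r' ∧ {s : ℝ | 0 ≤ s ∧ r' < ℓ s}.Nonempty)
    (hleft : Tendsto τ (nhdsWithin r (Set.Iio r)) (nhds (τ r))) :
    Tendsto (fun n => τn n r) atTop (nhds (τ r)) := by
  obtain ⟨r', hrr', s1, hs1, hs1'⟩ := hfin
  have hpt : ∀ s : ℝ, 0 ≤ s → Tendsto (fun n => ℓn n s) atTop (nhds (ℓ s)) := by
    intro s hs
    exact (hconv (s + 1) (by linarith)).tendsto_at ⟨hs, by linarith⟩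
  have hbdd : ∀ (f : ℝ → ℝ) (u : ℝ), BddBelow {s : ℝ | 0 ≤ s ∧ u < f s} :=
    fun f u => ⟨0, fun s hs => hs.1⟩
  rw [tendsto_order]
  constructor
  · intro a ha
    by_cases ha0 : a < 0
    · refine Eventually.of_forall fun n => lt_of_lt_of_le ha0 ?_
      rw [hτn]
      exact Real.sInf_nonneg fun s hs => hs.1
    · push Not at ha0
      obtain ⟨c, hac, hc⟩ := exists_between ha
      have hc0 : 0 ≤ c := ha0.trans hac.le
      have h1 : ∀ᶠ u in nhdsWithin r (Set.Iio r), c < τ u := hleft.eventually_const_lt hc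
      obtain ⟨u, hu, hur⟩ := (h1.and self_mem_nhdsWithin).exists
      have hur' : u < r := hur
      have hlc : ℓ c ≤ u := by
        by_contra! h
        rw [hτ] at hu
        exact absurd (csInf_le (hbdd ℓ u) ⟨hc0, h⟩) (not_le.mpr hu)
      filter_upwards [(hpt c hc0).eventually_lt_const (hlc.trans_lt hur'),
        (hpt s1 hs1).eventually_const_lt (hrr'.trans hs1')] with n hn hn1
      refine lt_of_lt_of_le hac ?_
      rw [hτn]
      refine le_csInf ⟨s1, hs1, hn1⟩ ?_
      rintro s ⟨hs0, hs⟩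
      by_contra! h
      have := hmono_n n hs0 hc0 h.le
      linarith
  · intro b hb
    rw [hτ] at hb
    have hne : {s : ℝ | 0 ≤ s ∧ r < ℓ s}.Nonempty := ⟨s1, hs1, hrr'.trans hs1'⟩
    obtain ⟨s0, ⟨hs0, hs0'⟩, hsb⟩ := exists_lt_of_csInf_lt hne hb
    filter_upwards [(hpt s0 hs0).eventually_const_lt hs0'] with n hn
    rw [hτn]
    exact (csInf_le (hbdd (ℓn n) r) ⟨hs0, hn⟩).trans_lt hsb
end
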